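/- arXiv:1709.05389 — 2 statements merged into one kernel-verified Lean document; each statement's English description precedes it below -/
import Mathlib

section
/- For every complex number s with Re(s) > −1 and s ≠ 1, and every natural number m with m > Re(s) − 1, the Riemann zeta function satisfies ζ(s) = 1/2 + 1/(s−1) + ∫₀^∞ w_s(x)/(1 + x²) dx. -/
open Real Complex MeasureTheory Set

/-- `g t = 1/(e^{2πt} - 1)`. -/
noncomputable def g (t : ℝ) : ℝ := 1 / (Real.exp (2 * π * t) - 1)

/-- The weight function
`w_s(x) = (2(−1)^m x^s)/(Γ(s)Γ(m+1−s)) · ∫_x^∞ (t−x)^{m−s} g^{(m)}(t) dt`. -/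
noncomputable def w (s : ℂ) (m : ℕ) (x : ℝ) : ℂ :=
  (2 * (-1) ^ m * (x : ℂ) ^ s) / (Complex.Gamma s * Complex.Gamma ((m : ℂ) + 1 - s)) *
    ∫ t in Ioi x, ((t - x : ℝ) : ℂ) ^ ((m : ℂ) - s) * ((iteratedDeriv m g t : ℝ) : ℂ)

/-- The frequencies `2π, 4π, 6π, …`. -/
noncomputable def freq (k : ℕ) : ℝ := 2 * π * (k + 1)

lemma freq_pos (k : ℕ) : 0 < freq k := by unfold freq; positivity

lemma one_le_freq (k : ℕ) : 1 ≤ freq k := by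
  have := Real.pi_gt_three
  have hk : (0 : ℝ) ≤ k := k.cast_nonneg
  unfold freq
  nlinarith

lemma summable_freq_pow_mul_exp (n : ℕ) {t : ℝ} (ht : 0 < t) :
    Summable fun k ↦ freq k ^ n * Real.exp (-freq k * t) := by
  have h := (summable_nat_add_iff 1).mpr
    (Real.summable_pow_mul_exp_neg_nat_mul n (r := 2 * π * t) (by positivity))
  refine (h.mul_left ((2 * π) ^ n)).congr fun k ↦ ?_
  simp only [freq, mul_pow]
  push_cast
  ring_nf

lemma summable_one_div_freq_sq : Summable fun k ↦ 1 / freq k ^ 2 := by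
  have h := (summable_nat_add_iff 1).mpr (Real.summable_one_div_nat_pow.mpr one_lt_two)
  refine (h.mul_left (1 / (2 * π) ^ 2)).congr fun k ↦ ?_
  simp only [freq, mul_pow]
  push_cast
  field_simp

lemma hasSum_exp_neg_succ_mul {t : ℝ} (ht : 0 < t) :
    HasSum (fun k : ℕ ↦ Real.exp (-((k : ℝ) + 1) * t)) (1 / (Real.exp t - 1)) := by
  have h1 : Real.exp (-t) < 1 := by simpa using ht
  have h := (hasSum_geometric_of_lt_one (Real.exp_pos _).le h1).mul_left (Real.exp (-t))
  have h2 : 0 < Real.exp t - 1 := by simpa using ht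
  convert! h using 1
  · ext k
    rw [← Real.exp_nat_mul, ← Real.exp_add]
    ring_nf
  · rw [Real.exp_neg]
    field_simp

lemma g_eq_tsum {t : ℝ} (ht : 0 < t) : g t = ∑' k, Real.exp (-freq k * t) := by
  rw [g, ← (hasSum_exp_neg_succ_mul (t := 2 * π * t) (by positivity)).tsum_eq]
  refine tsum_congr fun k ↦ ?_
  rw [freq]
  ring_nf

lemma hasDerivAt_tsum_exp (n : ℕ) {t : ℝ} (ht : 0 < t) :
    HasDerivAt (fun t ↦ ∑' k, (-freq k) ^ n * Real.exp (-freq k * t))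
      (∑' k, (-freq k) ^ (n + 1) * Real.exp (-freq k * t)) t := by
  have hs : ∀ n, ∀ {r : ℝ}, 0 < r → Summable fun k ↦ ‖(-freq k) ^ n * Real.exp (-freq k * r)‖ := by
    intro n r hr
    refine (summable_freq_pow_mul_exp n hr).congr fun k ↦ ?_
    rw [norm_mul, norm_pow, norm_neg, Real.norm_of_nonneg (freq_pos k).le,
      Real.norm_of_nonneg (Real.exp_pos _).le]
  have key := hasDerivAt_tsum_of_isPreconnected (y₀ := t) (y := t)
    (g := fun k y ↦ (-freq k) ^ n * Real.exp (-freq k * y))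
    (g' := fun k y ↦ (-freq k) ^ (n + 1) * Real.exp (-freq k * y)) (hs (n + 1) (half_pos ht))
    (isOpen_Ioi (a := t / 2)) isPreconnected_Ioi ?_ ?_ (half_lt_self ht) (hs n ht).of_norm
    (half_lt_self ht)
  · exact key
  · intro k y _
    have h := ((hasDerivAt_id y).const_mul (-freq k)).exp.const_mul ((-freq k) ^ n)
    convert! h using 1
    simp only [id]
    ring
  · intro k y hy
    rw [norm_mul, norm_mul, Real.norm_of_nonneg (Real.exp_pos _).le,
      Real.norm_of_nonneg (Real.exp_pos _).le]
    have h1 : -freq k * y ≤ -freq k * (t / 2) := by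
      have := mul_le_mul_of_nonneg_left (le_of_lt (mem_Ioi.mp hy)) (freq_pos k).le
      linarith
    exact mul_le_mul_of_nonneg_left (Real.exp_le_exp.mpr h1) (norm_nonneg _)

lemma iteratedDeriv_g (n : ℕ) : ∀ {t : ℝ}, 0 < t →
    iteratedDeriv n g t = ∑' k, (-freq k) ^ n * Real.exp (-freq k * t) := by
  induction n with
  | zero => intro t ht; simp [g_eq_tsum ht]
  | succ n ih =>
    intro t ht
    rw [iteratedDeriv_succ]
    have h : iteratedDeriv n g =ᶠ[nhds t]
        fun t ↦ ∑' k, (-freq k) ^ n * Real.exp (-freq k * t) := by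
      filter_upwards [lt_mem_nhds ht] with y hy using ih hy
    rw [h.deriv_eq, (hasDerivAt_tsum_exp n ht).deriv]

lemma hasSum_iteratedDeriv_g (n : ℕ) {t : ℝ} (ht : 0 < t) :
    HasSum (fun k ↦ (-freq k) ^ n * Real.exp (-freq k * t)) (iteratedDeriv n g t) := by
  rw [iteratedDeriv_g n ht]
  refine Summable.hasSum (((summable_freq_pow_mul_exp n ht).mul_left ((-1) ^ n)).congr fun k ↦ ?_)
  rw [neg_pow (freq k)]
  ring

lemma hasSum_integral_cpow_sub_mul_iteratedDeriv_g {s : ℂ} {m : ℕ} (hm : s.re - 1 < m) {x : ℝ}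
    (hx : 0 < x) :
    HasSum (fun k ↦ (-1) ^ m * Complex.Gamma (m + 1 - s) *
        ((freq k : ℂ) ^ (s - 1) * Real.exp (-freq k * x)))
      (∫ t in Ioi x, ((t - x : ℝ) : ℂ) ^ ((m : ℂ) - s) * ((iteratedDeriv m g t : ℝ) : ℂ)) := by
  have hre : 0 < ((m : ℂ) + 1 - s).re := by simp; linarith
  have h := hasSum_mellin (a := fun k ↦ (((-freq k) ^ m * Real.exp (-freq k * x) : ℝ) : ℂ))
    (p := freq) (F := fun v ↦ ((iteratedDeriv m g (v + x) : ℝ) : ℂ))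
    (s := (m : ℂ) + 1 - s) (fun k ↦ Or.inr (freq_pos k)) hre ?_ ?_
  · convert! h using 1
    · ext k
      have hk : (freq k : ℂ) ≠ 0 := by exact_mod_cast (freq_pos k).ne'
      have : (freq k : ℂ) ^ (s - 1) * (freq k : ℂ) ^ ((m : ℂ) + 1 - s) = (freq k : ℂ) ^ m := by
        rw [← Complex.cpow_add _ _ hk, ← Complex.cpow_natCast]
        ring_nf
      have hne : (freq k : ℂ) ^ ((m : ℂ) + 1 - s) ≠ 0 := by simp [Complex.cpow_eq_zero_iff, hk]
      rw [eq_div_iff hne]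
      push_cast
      rw [neg_pow (freq k : ℂ), ← this]
      ring
    · rw [mellin, ← integral_indicator measurableSet_Ioi, ← integral_indicator measurableSet_Ioi,
        ← integral_add_right_eq_self _ x]
      refine integral_congr_ae (.of_forall fun v ↦ ?_)
      by_cases hv : 0 < v
      · simp [indicator, hv, add_sub_right_comm]
      · simp [indicator, hv]
  · intro t ht
    have h := (hasSum_iteratedDeriv_g m (add_pos (mem_Ioi.mp ht) hx)).mapL Complex.ofRealCLM
    convert! h using 1
    ext k
    simp only [Complex.ofRealCLM_apply]
    rw [← Complex.ofReal_mul, mul_add, Real.exp_add]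
    congr 1
    ring
  · refine Summable.of_nonneg_of_le (fun k ↦ by have := freq_pos k; positivity) (fun k ↦ ?_)
      (summable_freq_pow_mul_exp m hx)
    have h1 : 1 ≤ freq k ^ ((m : ℂ) + 1 - s).re := Real.one_le_rpow (one_le_freq k) hre.le
    refine (div_le_self (norm_nonneg _) h1).trans_eq ?_
    rw [Complex.norm_real, norm_mul, norm_pow, norm_neg, Real.norm_of_nonneg (freq_pos k).le,
      Real.norm_of_nonneg (Real.exp_pos _).le]

lemma w_eq_tsum {s : ℂ} {m : ℕ} (hm : s.re - 1 < m) {x : ℝ} (hx : 0 < x) :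
    w s m x = 2 * (x : ℂ) ^ s / Complex.Gamma s *
      ∑' k, (freq k : ℂ) ^ (s - 1) * Real.exp (-freq k * x) := by
  have hG : Complex.Gamma (m + 1 - s) ≠ 0 :=
    Complex.Gamma_ne_zero_of_re_pos (by simp; linarith)
  rw [w, ← (hasSum_integral_cpow_sub_mul_iteratedDeriv_g hm hx).tsum_eq, tsum_mul_left]
  have h1 : ((-1 : ℂ) ^ m) * (-1) ^ m = 1 := by rw [← mul_pow]; simp
  generalize (∑' k, (freq k : ℂ) ^ (s - 1) * Real.exp (-freq k * x)) = T
  rw [div_mul_eq_div_div, div_mul_eq_mul_div, div_eq_iff hG]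
  linear_combination (2 * (x : ℂ) ^ s / Complex.Gamma s * T * Complex.Gamma (m + 1 - s)) * h1

/-- The kernel `∑ 1 / ((2πk)² + u²)`, the sum being over `k ≥ 1`. -/
noncomputable def invSqSum (u : ℝ) : ℝ := ∑' k, 1 / (freq k ^ 2 + u ^ 2)

lemma one_div_freq_sq_add_le (k : ℕ) (u : ℝ) : 1 / (freq k ^ 2 + u ^ 2) ≤ 1 / freq k ^ 2 := by
  have := freq_pos k
  gcongr
  nlinarith [sq_nonneg u]

lemma summable_one_div_freq_sq_add (u : ℝ) : Summable fun k ↦ 1 / (freq k ^ 2 + u ^ 2) :=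
  summable_one_div_freq_sq.of_nonneg_of_le (fun k ↦ by positivity)
    fun k ↦ one_div_freq_sq_add_le k u

lemma invSqSum_nonneg (u : ℝ) : 0 ≤ invSqSum u := tsum_nonneg fun k ↦ by positivity

lemma invSqSum_le (u : ℝ) : invSqSum u ≤ ∑' k, 1 / freq k ^ 2 :=
  (summable_one_div_freq_sq_add u).tsum_le_tsum (fun k ↦ one_div_freq_sq_add_le k u)
    summable_one_div_freq_sq

lemma continuous_invSqSum : Continuous invSqSum := by
  refine continuous_tsum (fun k ↦ ?_) summable_one_div_freq_sq fun k u ↦ ?_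
  · have := freq_pos k
    exact continuous_const.div (by fun_prop) fun u ↦ by positivity
  · rw [Real.norm_of_nonneg (by positivity)]
    exact one_div_freq_sq_add_le k u

lemma two_mul_mul_invSqSum {u : ℝ} (hu : 0 < u) :
    2 * u * invSqSum u = 1 / (Real.exp u - 1) + 1 / 2 - 1 / u := by
  have hπ : (π : ℂ) ≠ 0 := by exact_mod_cast Real.pi_ne_zero
  have hu' : (u : ℂ) ≠ 0 := by exact_mod_cast hu.ne'
  set z : ℂ := Complex.I * u / (2 * π) with hz
  have hzim : 0 < z.im := by
    have : z = ((u / (2 * π) : ℝ) : ℂ) * Complex.I := by rw [hz]; push_cast; ring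
    rw [this, Complex.im_ofReal_mul, Complex.I_im]
    positivity
  have hcot := cot_series_rep' (UpperHalfPlane.coe_mem_integerComplement ⟨z, hzim⟩)
  have hterm : ∀ k : ℕ, 1 / (z - (k + 1)) + 1 / (z + (k + 1)) =
      (-(4 * π * Complex.I * u)) * ((1 / (freq k ^ 2 + u ^ 2) : ℝ) : ℂ) := by
    intro k
    have hne := fun n : ℤ ↦ UpperHalfPlane.ne_intCast ⟨z, hzim⟩ n
    have h1 : z - (k + 1) ≠ 0 := fun h ↦ hne (k + 1) (by push_cast; linear_combination h)
    have h2 : z + (k + 1) ≠ 0 := fun h ↦ hne (-(k + 1)) (by push_cast; linear_combination h)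
    have h3 : (((freq k ^ 2 + u ^ 2 : ℝ)) : ℂ) ≠ 0 := by
      exact_mod_cast (by have := freq_pos k; positivity : freq k ^ 2 + u ^ 2 ≠ 0)
    have h4 : (((freq k ^ 2 + u ^ 2 : ℝ)) : ℂ) = -(4 * π ^ 2) * ((z - (k + 1)) * (z + (k + 1))) := by
      rw [hz, freq]
      push_cast
      field_simp
      linear_combination (4 * (u : ℂ) ^ 2) * Complex.I_sq
    rw [Complex.ofReal_div, h4, Complex.ofReal_one]
    field_simp
    rw [hz]
    field_simp
    ring
  simp only at hcot
  rw [tsum_congr hterm, tsum_mul_left, ← Complex.ofReal_tsum, Complex.cot_pi_eq_exp_ratio] at hcot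
  have hexp : Complex.exp (2 * π * Complex.I * z) = ((Real.exp (-u) : ℝ) : ℂ) := by
    push_cast
    congr 1
    rw [hz]
    field_simp
    linear_combination Complex.I_sq
  have hE : Real.exp u - 1 ≠ 0 := by
    have : 0 < Real.exp u - 1 := by simpa using hu
    exact this.ne'
  have hE' : (Real.exp u : ℂ) - 1 ≠ 0 := by exact_mod_cast hE
  have hE0 : (Real.exp u : ℂ) ≠ 0 := by exact_mod_cast (Real.exp_pos u).ne'
  rw [hexp, Real.exp_neg] at hcot
  change _ = _ * ((invSqSum u : ℝ) : ℂ) at hcot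
  rw [← Complex.ofReal_inj]
  push_cast [-Complex.ofReal_exp] at hcot ⊢
  generalize (Real.exp u : ℂ) = E at *
  have hE1 : 1 - E⁻¹ ≠ 0 := by
    rw [← div_self hE0, ← one_div, ← sub_div]
    exact div_ne_zero hE' hE0
  have h5 : (1 - E⁻¹) = (E - 1) / E := by field_simp
  have h6 : (E⁻¹ + 1) = (E + 1) / E := by field_simp; ring
  have h7 : (π : ℂ) * ((E⁻¹ + 1) / (Complex.I * (1 - E⁻¹))) - 1 / z =
      (-(2 * π * Complex.I)) * (1 / (E - 1) + 1 / 2 - 1 / u) := by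
    rw [h5, h6, hz]
    field_simp
    linear_combination (-(2 * (E - 1)) + u * (E + 1) : ℂ) * Complex.I_sq
  rw [h7] at hcot
  have hne : (-(2 * π * Complex.I)) ≠ 0 := by simp [hπ]
  apply mul_left_cancel₀ hne
  linear_combination -hcot

lemma exp_neg_mul_invSqSum {u : ℝ} (hu : 0 < u) :
    2 * u * (Real.exp (-u) * invSqSum u) =
      1 / (Real.exp u - 1) - Real.exp (-u) / 2 - Real.exp (-u) / u := by
  have hE : Real.exp u - 1 ≠ 0 := by
    have : 0 < Real.exp u - 1 := by simpa using hu
    exact this.ne'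
  have hE0 := (Real.exp_pos u).ne'
  have h : Real.exp (-u) * (1 / (Real.exp u - 1)) = 1 / (Real.exp u - 1) - Real.exp (-u) := by
    rw [Real.exp_neg]
    field_simp
    ring
  linear_combination Real.exp (-u) * two_mul_mul_invSqSum hu + h

lemma isBigO_exp_neg_mul_invSqSum (l : Filter ℝ) :
    (fun u : ℝ ↦ ((Real.exp (-u) * invSqSum u : ℝ) : ℂ)) =O[l] fun u ↦ Real.exp (-1 * u) := by
  refine Asymptotics.IsBigO.of_bound (∑' k, 1 / freq k ^ 2) (.of_forall fun u ↦ ?_)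
  rw [Complex.norm_real, norm_mul, Real.norm_of_nonneg (invSqSum_nonneg u), neg_one_mul, mul_comm]
  exact mul_le_mul_of_nonneg_right (invSqSum_le u) (norm_nonneg _)

lemma locallyIntegrableOn_exp_neg_mul_invSqSum :
    LocallyIntegrableOn (fun u : ℝ ↦ ((Real.exp (-u) * invSqSum u : ℝ) : ℂ)) (Ioi 0) := by
  have := continuous_invSqSum
  exact Continuous.locallyIntegrable (by fun_prop) |>.locallyIntegrableOn _

lemma isBigO_exp_neg_mul_invSqSum_nhdsGT_zero :
    (fun u : ℝ ↦ ((Real.exp (-u) * invSqSum u : ℝ) : ℂ)) =O[nhdsWithin 0 (Ioi 0)]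
      fun u ↦ u ^ (-(0 : ℝ)) := by
  refine (isBigO_exp_neg_mul_invSqSum _).trans ?_
  simp only [neg_zero, Real.rpow_zero]
  have h : Continuous fun u : ℝ ↦ Real.exp (-1 * u) := by fun_prop
  exact (h.tendsto 0).mono_left nhdsWithin_le_nhds |>.isBigO_one ℝ

lemma mellinConvergent_exp_neg_mul_invSqSum {s : ℂ} (hs : 0 < s.re) :
    MellinConvergent (fun u : ℝ ↦ ((Real.exp (-u) * invSqSum u : ℝ) : ℂ)) s :=
  mellinConvergent_of_isBigO_rpow_exp one_pos locallyIntegrableOn_exp_neg_mul_invSqSum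
    (isBigO_exp_neg_mul_invSqSum _) isBigO_exp_neg_mul_invSqSum_nhdsGT_zero hs

lemma differentiableAt_mellin_exp_neg_mul_invSqSum {s : ℂ} (hs : 0 < s.re) :
    DifferentiableAt ℂ (mellin fun u : ℝ ↦ ((Real.exp (-u) * invSqSum u : ℝ) : ℂ)) s :=
  mellin_differentiableAt_of_isBigO_rpow_exp one_pos locallyIntegrableOn_exp_neg_mul_invSqSum
    (isBigO_exp_neg_mul_invSqSum _) isBigO_exp_neg_mul_invSqSum_nhdsGT_zero hs

lemma mellin_one_div_exp_sub_one {s : ℂ} (hs : 1 < s.re) :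
    mellin (fun u : ℝ ↦ ((1 / (Real.exp u - 1) : ℝ) : ℂ)) s = Complex.Gamma s * riemannZeta s := by
  have h := hasSum_mellin (a := fun _ : ℕ ↦ (1 : ℂ)) (p := fun k : ℕ ↦ (k : ℝ) + 1)
    (F := fun u : ℝ ↦ ((1 / (Real.exp u - 1) : ℝ) : ℂ)) (s := s) (fun k ↦ Or.inr (by positivity))
    (by linarith) ?_ ?_
  · rw [← h.tsum_eq, zeta_eq_tsum_one_div_nat_add_one_cpow hs, ← tsum_mul_left]
    refine tsum_congr fun k ↦ ?_
    push_cast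
    ring
  · intro t ht
    have h := (hasSum_exp_neg_succ_mul (mem_Ioi.mp ht)).mapL Complex.ofRealCLM
    convert! h using 1
    ext k
    simp
  · have h := (summable_nat_add_iff 1).mpr (Real.summable_one_div_nat_rpow.mpr hs)
    simpa using h

lemma mellin_exp_neg_mul_invSqSum_of_one_lt_re {s : ℂ} (hs : 1 < s.re) :
    2 * mellin (fun u : ℝ ↦ ((Real.exp (-u) * invSqSum u : ℝ) : ℂ)) (s + 1) =
      Complex.Gamma s * (riemannZeta s - 1 / 2) - Complex.Gamma (s - 1) := by
  have h1 := (mellinConvergent_exp_neg_mul_invSqSum (s := s + 1) (by simp; linarith)).const_mul 2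
  have h2 := (Complex.GammaIntegral_convergent (s := s) (by linarith)).const_mul (1 / 2)
  have h3 := Complex.GammaIntegral_convergent (s := s - 1) (by simpa using hs)
  have h4 : mellin (fun u : ℝ ↦ ((1 / (Real.exp u - 1) : ℝ) : ℂ)) s =
      2 * mellin (fun u : ℝ ↦ ((Real.exp (-u) * invSqSum u : ℝ) : ℂ)) (s + 1) +
        1 / 2 * Complex.Gamma s + Complex.Gamma (s - 1) := by
    rw [Complex.Gamma_eq_integral (s := s) (by linarith),
      Complex.Gamma_eq_integral (s := s - 1) (by simpa using hs), Complex.GammaIntegral,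
      Complex.GammaIntegral, mellin, mellin, ← integral_const_mul, ← integral_const_mul,
      ← integral_add' h1 h2, ← integral_add' (h1.add h2) h3]
    refine setIntegral_congr_fun measurableSet_Ioi fun u hu ↦ ?_
    have hu' : (u : ℂ) ≠ 0 := by exact_mod_cast (ne_of_gt (mem_Ioi.mp hu))
    have h5 := congrArg (fun r : ℝ ↦ (r : ℂ)) (exp_neg_mul_invSqSum (mem_Ioi.mp hu))
    simp only [Pi.add_apply, smul_eq_mul, Complex.ofReal_mul, Complex.ofReal_sub,
      Complex.ofReal_div, Complex.ofReal_ofNat] at h5 ⊢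
    rw [add_sub_cancel_right, Complex.cpow_sub _ _ hu', Complex.cpow_sub (s - 1) _ hu',
      Complex.cpow_sub _ _ hu', Complex.cpow_one]
    field_simp at h5 ⊢
    linear_combination (-(u : ℂ) ^ s) * h5
  rw [mellin_one_div_exp_sub_one hs] at h4
  linear_combination -h4

lemma riemannZeta_eq_mellin_exp_neg_mul_invSqSum {s : ℂ} (hs : -1 < s.re) (hs1 : s ≠ 1) :
    riemannZeta s = 1 / 2 + 1 / (s - 1) + 2 * (Complex.Gamma s)⁻¹ *
      mellin (fun u : ℝ ↦ ((Real.exp (-u) * invSqSum u : ℝ) : ℂ)) (s + 1) := by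
  set D : ℂ → ℂ := fun s ↦ riemannZeta s - 1 / (s - 1) / Complex.Gammaℝ s with hD
  set M : ℂ → ℂ := mellin (fun u : ℝ ↦ ((Real.exp (-u) * invSqSum u : ℝ) : ℂ))
  have hDdiff : Differentiable ℂ D := by
    intro z
    by_cases hz : z = 1
    · rw [hz]
      have h := HurwitzZeta.differentiableAt_hurwitzZetaEven_sub_one_div 0
      rwa [HurwitzZeta.hurwitzZetaEven_zero] at h
    · have h1 := differentiableAt_riemannZeta hz
      have h2 := Complex.differentiable_Gammaℝ_inv z
      have h3 : z - 1 ≠ 0 := sub_ne_zero.mpr hz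
      have h4 : DifferentiableAt ℂ (fun s : ℂ ↦ 1 / (s - 1)) z := by fun_prop (disch := exact h3)
      exact h1.sub (h4.mul h2)
  have hUo : IsOpen {z : ℂ | -1 < z.re} := isOpen_lt continuous_const Complex.continuous_re
  have hL : AnalyticOnNhd ℂ (fun z ↦ (z - 1) * D z + (Complex.Gammaℝ z)⁻¹) {z | -1 < z.re} := by
    refine DifferentiableOn.analyticOnNhd (Differentiable.differentiableOn ?_) hUo
    have h : Differentiable ℂ (fun z : ℂ ↦ z - 1) := by fun_prop
    exact (h.mul hDdiff).add Complex.differentiable_Gammaℝ_inv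
  have hR : AnalyticOnNhd ℂ
      (fun z ↦ (z - 1) / 2 + 1 + (z - 1) * (2 * (Complex.Gamma z)⁻¹ * M (z + 1)))
      {z | -1 < z.re} := by
    refine DifferentiableOn.analyticOnNhd (fun z hz ↦ DifferentiableAt.differentiableWithinAt ?_) hUo
    have hM : DifferentiableAt ℂ (fun z ↦ M (z + 1)) z := by
      have hz : -1 < z.re := hz
      have h1 : DifferentiableAt ℂ M (z + 1) :=
        differentiableAt_mellin_exp_neg_mul_invSqSum (by simp; linarith)
      have h2 : DifferentiableAt ℂ (fun z : ℂ ↦ z + 1) z := by fun_prop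
      exact DifferentiableAt.comp (g := M) (f := fun z ↦ z + 1) z h1 h2
    have hG := Complex.differentiable_one_div_Gamma z
    have h1 : DifferentiableAt ℂ (fun z : ℂ ↦ (z - 1) / 2 + 1) z := by fun_prop
    have h2 : DifferentiableAt ℂ (fun z : ℂ ↦ z - 1) z := by fun_prop
    exact h1.add (h2.mul ((hG.const_mul 2).mul hM))
  have hev : (fun z ↦ (z - 1) * D z + (Complex.Gammaℝ z)⁻¹) =ᶠ[nhds 2]
      (fun z ↦ (z - 1) / 2 + 1 + (z - 1) * (2 * (Complex.Gamma z)⁻¹ * M (z + 1))) := by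
    have hV : {z : ℂ | 1 < z.re} ∈ nhds (2 : ℂ) :=
      (isOpen_lt continuous_const Complex.continuous_re).mem_nhds (by simp)
    filter_upwards [hV] with z hz
    have hz : 1 < z.re := hz
    have hz1 : z - 1 ≠ 0 := fun h ↦ by
      rw [sub_eq_zero.mp h] at hz
      simp at hz
    have hG : Complex.Gamma z ≠ 0 := Complex.Gamma_ne_zero_of_re_pos (by linarith)
    have h := mellin_exp_neg_mul_invSqSum_of_one_lt_re hz
    have hΓ : Complex.Gamma z = (z - 1) * Complex.Gamma (z - 1) := by
      rw [← Complex.Gamma_add_one _ hz1, sub_add_cancel]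
    change 2 * M (z + 1) = _ at h
    have h2 : 2 * (Complex.Gamma z)⁻¹ * M (z + 1) =
        (Complex.Gamma z)⁻¹ * (Complex.Gamma z * (riemannZeta z - 1 / 2) - Complex.Gamma (z - 1)) := by
      rw [← h]
      ring
    have h3 : (z - 1) * ((Complex.Gamma z)⁻¹ * Complex.Gamma (z - 1)) = 1 := by
      rw [mul_left_comm, ← hΓ, inv_mul_cancel₀ hG]
    rw [h2, mul_sub (Complex.Gamma z)⁻¹, inv_mul_cancel_left₀ hG, hD]
    have h4 : (z - 1) * (1 / (z - 1)) = 1 := by field_simp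
    linear_combination (-(Complex.Gammaℝ z)⁻¹) * h4 + h3
  have h := hL.eqOn_of_preconnected_of_eventuallyEq hR
    (convex_halfSpace_re_gt (-1)).isPreconnected (by simp; norm_num) hev hs
  have hs1' : s - 1 ≠ 0 := sub_ne_zero.mpr hs1
  have h4 : (s - 1) * (1 / (s - 1)) = 1 := by field_simp
  simp only [hD] at h
  apply mul_left_cancel₀ hs1'
  linear_combination h + ((Complex.Gammaℝ s)⁻¹ - 1) * h4

lemma integral_tsum_cpow_mul_exp_div_eq_mellin {s : ℂ} (hs : -1 < s.re) :
    ∫ x in Ioi (0 : ℝ), ∑' k, (x : ℂ) ^ s * ((freq k : ℂ) ^ (s - 1) * Real.exp (-freq k * x)) /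
        ((1 + x ^ 2 : ℝ) : ℂ) =
      mellin (fun u : ℝ ↦ ((Real.exp (-u) * invSqSum u : ℝ) : ℂ)) (s + 1) := by
  set G : ℕ → ℝ → ℂ := fun k u ↦
    ((Real.exp (-u) : ℂ) * (u : ℂ) ^ s) * ((1 / (freq k ^ 2 + u ^ 2) : ℝ) : ℂ) with hG
  set F : ℕ → ℝ → ℂ := fun k x ↦ (x : ℂ) ^ s * ((freq k : ℂ) ^ (s - 1) * Real.exp (-freq k * x)) /
        ((1 + x ^ 2 : ℝ) : ℂ) with hF
  have hΓ : IntegrableOn (fun u : ℝ ↦ (Real.exp (-u) : ℂ) * (u : ℂ) ^ s) (Ioi 0) := by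
    have := Complex.GammaIntegral_convergent (s := s + 1) (by simp; linarith)
    simpa using this
  have hbound : ∀ k u, ‖G k u‖ ≤ ‖(Real.exp (-u) : ℂ) * (u : ℂ) ^ s‖ * (1 / freq k ^ 2) := by
    intro k u
    simp only [hG]
    rw [norm_mul, Complex.norm_real, Real.norm_of_nonneg (by positivity)]
    exact mul_le_mul_of_nonneg_left (one_div_freq_sq_add_le k u) (norm_nonneg _)
  have hGint : ∀ k, IntegrableOn (G k) (Ioi 0) := by
    intro k
    refine (hΓ.norm.mul_const (1 / freq k ^ 2)).mono' (hΓ.1.mul ?_) (.of_forall (hbound k))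
    have := freq_pos k
    have hc : Continuous fun u : ℝ ↦ 1 / (freq k ^ 2 + u ^ 2) :=
      continuous_const.div (by fun_prop) fun u ↦ by positivity
    exact (Complex.continuous_ofReal.comp hc).aestronglyMeasurable
  have hGsum : Summable fun k ↦ ∫ u in Ioi (0 : ℝ), ‖G k u‖ := by
    refine (summable_one_div_freq_sq.mul_left
      (∫ u in Ioi (0 : ℝ), ‖(Real.exp (-u) : ℂ) * (u : ℂ) ^ s‖)).of_nonneg_of_le
      (fun k ↦ integral_nonneg fun u ↦ norm_nonneg _) fun k ↦ ?_
    rw [← integral_mul_const]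
    exact integral_mono (hGint k).norm (hΓ.norm.mul_const _) (hbound k)
  have hFG : ∀ k, EqOn (F k) (fun x ↦ (freq k : ℂ) * G k (freq k * x)) (Ioi 0) := by
    intro k x hx
    have hx : 0 < x := hx
    have hk := freq_pos k
    have hk' : (freq k : ℂ) ≠ 0 := by exact_mod_cast hk.ne'
    have h1 : ((1 + x ^ 2 : ℝ) : ℂ) ≠ 0 := by
      exact_mod_cast (by positivity : 1 + x ^ 2 ≠ 0)
    have h2 : freq k ^ 2 + (freq k * x) ^ 2 = freq k ^ 2 * (1 + x ^ 2) := by ring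
    simp only [hF, hG, h2, ← neg_mul]
    rw [Complex.ofReal_mul (freq k) x, Complex.mul_cpow_ofReal_nonneg hk.le hx.le,
      Complex.cpow_sub _ _ hk', Complex.cpow_one, Complex.ofReal_div, Complex.ofReal_mul,
      Complex.ofReal_pow, Complex.ofReal_one]
    field_simp
  have hFint : ∀ k, IntegrableOn (F k) (Ioi 0) := by
    intro k
    refine IntegrableOn.congr_fun ?_ (hFG k).symm measurableSet_Ioi
    refine Integrable.const_mul ?_ _
    exact (integrableOn_Ioi_comp_mul_left_iff (G k) 0 (freq_pos k)).mpr
      (by simpa using hGint k)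
  have hFeq : ∀ k, ∫ x in Ioi (0 : ℝ), F k x = ∫ u in Ioi (0 : ℝ), G k u := by
    intro k
    rw [setIntegral_congr_fun measurableSet_Ioi (hFG k), integral_const_mul,
      ← Complex.real_smul, integral_comp_mul_left_Ioi' (G k) 0 (freq_pos k), mul_zero]
  have hFnorm : ∀ k, ∫ x in Ioi (0 : ℝ), ‖F k x‖ = ∫ u in Ioi (0 : ℝ), ‖G k u‖ := by
    intro k
    have h : EqOn (fun x ↦ ‖F k x‖) (fun x ↦ freq k * ‖G k (freq k * x)‖) (Ioi 0) := by
      intro x hx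
      simp only [hFG k hx]
      rw [norm_mul, Complex.norm_real, Real.norm_of_nonneg (freq_pos k).le]
    rw [setIntegral_congr_fun measurableSet_Ioi h, integral_const_mul, ← smul_eq_mul,
      integral_comp_mul_left_Ioi' (fun u ↦ ‖G k u‖) 0 (freq_pos k), mul_zero]
  have h1 := hasSum_integral_of_summable_integral_norm hFint (by simpa only [hFnorm] using hGsum)
  have h2 := hasSum_integral_of_summable_integral_norm hGint hGsum
  rw [← h1.tsum_eq, tsum_congr hFeq, h2.tsum_eq, mellin]
  refine integral_congr_ae (.of_forall fun u ↦ ?_)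
  simp only [hG, tsum_mul_left, smul_eq_mul, add_sub_cancel_right]
  rw [← Complex.ofReal_tsum, Complex.ofReal_mul, invSqSum]
  ring

theorem riemannZeta_eq_integral_weight (s : ℂ) (hs : -1 < s.re) (hs1 : s ≠ 1)
    (m : ℕ) (hm : s.re - 1 < m) :
    riemannZeta s =
      1 / 2 + 1 / (s - 1) + ∫ x in Ioi (0 : ℝ), w s m x / ((1 + x ^ 2 : ℝ) : ℂ) := by
  rw [riemannZeta_eq_mellin_exp_neg_mul_invSqSum hs hs1, ← integral_tsum_cpow_mul_exp_div_eq_mellin hs,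
    ← integral_const_mul]
  congr 1
  refine setIntegral_congr_fun measurableSet_Ioi fun x hx ↦ ?_
  simp only [w_eq_tsum hm (mem_Ioi.mp hx), tsum_div_const, tsum_mul_left]
  ring
end

section
/- Let s be a complex number with Re(s) > −1 and let m be a natural number with m > Re(s) − 1. Define F(t) = ∫₀^t x^s (t−x)^{m−s} / (1+x²) dx for t ≥ 0. Then for every real t ≥ 0, sin(s · arctan t) / (1+t²)^{s/2} = (1/(Γ(s)Γ(m+1−s))) · F^{(m)}(t), where F^{(m)} denotes the m-th derivative of F. -/
open Real Complex MeasureTheory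

/-- `F(t) = ∫₀^t x^s (t−x)^{m−s} / (1+x²) dx`. -/
noncomputable def F (s : ℂ) (m : ℕ) (t : ℝ) : ℂ :=
  ∫ x in (0 : ℝ)..t,
    ((x : ℝ) : ℂ) ^ s * ((t - x : ℝ) : ℂ) ^ ((m : ℂ) - s) / (1 + ((x : ℝ) : ℂ) ^ 2)

/-- A sequence of functions on an open set, each the derivative of the previous one, lists the
iterated derivatives of its first term. -/
theorem iteratedDeriv_eq_of_hasDerivAt_succ {𝕜 E : Type*} [NontriviallyNormedField 𝕜]
    [NormedAddCommGroup E] [NormedSpace 𝕜 E] {f : ℕ → 𝕜 → E} {U : Set 𝕜} (hU : IsOpen U)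
    (hf : ∀ n, ∀ w ∈ U, HasDerivAt (f n) (f (n + 1) w) w) (n : ℕ) :
    Set.EqOn (iteratedDeriv n (f 0)) (f n) U := by
  induction n with
  | zero => intro w _; simp
  | succ n ih =>
    intro w hw
    rw [iteratedDeriv_succ, (ih.eventuallyEq_of_mem (hU.mem_nhds hw)).deriv_eq]
    exact (hf n w hw).deriv

/-- An analytic function is determined, on a preconnected set, by its iterated derivatives at a
point. -/
theorem AnalyticOnNhd.eqOn_of_iteratedDeriv_eq {𝕜 : Type*} [NontriviallyNormedField 𝕜]
    [CompleteSpace 𝕜] [CharZero 𝕜] {f g : 𝕜 → 𝕜} {U : Set 𝕜} (hf : AnalyticOnNhd 𝕜 f U)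
    (hg : AnalyticOnNhd 𝕜 g U) (hU : IsPreconnected U) {z : 𝕜} (hz : z ∈ U)
    (h : ∀ n, iteratedDeriv n f z = iteratedDeriv n g z) : Set.EqOn f g U := by
  refine hf.eqOn_of_preconnected_of_eventuallyEq hg hU hz ?_
  have h₁ := (hf z hz).hasFPowerSeriesAt
  have h₂ := (hg z hz).hasFPowerSeriesAt
  simp only [← h] at h₂
  have h₃ := h₁.sub h₂
  rw [sub_self] at h₃
  filter_upwards [h₃.eventually_eq_zero] with w hw
  exact sub_eq_zero.mp hw

/-- On this half-plane `1 - w * u` has no zero for `u ∈ [0, 1]`. -/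
theorem isOpen_re_lt_one : IsOpen {w : ℂ | w.re < 1} :=
  isOpen_lt Complex.continuous_re continuous_const

theorem le_norm_one_sub_mul {c u : ℝ} {w : ℂ} (hc : c ≤ 1) (hw : w.re ≤ 1 - c)
    (hu₀ : 0 ≤ u) (hu₁ : u ≤ 1) : c ≤ ‖1 - w * u‖ := by
  have h : (1 - w * u).re = 1 - w.re * u := by simp
  calc c ≤ 1 - w.re * u := by nlinarith
    _ = (1 - w * u).re := h.symm
    _ ≤ ‖1 - w * u‖ := Complex.re_le_norm _

theorem one_sub_mul_ne_zero {u : ℝ} {w : ℂ} (hw : w.re < 1) (hu₀ : 0 ≤ u) (hu₁ : u ≤ 1) :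
    1 - w * u ≠ 0 := by
  rw [← norm_pos_iff]
  exact (lt_min one_pos (sub_pos.mpr hw)).trans_le
    (le_norm_one_sub_mul (min_le_left 1 (1 - w.re)) (by linarith [min_le_right 1 (1 - w.re)])
      hu₀ hu₁)

/-- The `n`-th derivative of the Stieltjes-type transform `w ↦ ∫₀¹ φ(u) / (1 - w u) du`. -/
noncomputable def stieltjesDeriv (φ : ℝ → ℂ) (n : ℕ) (w : ℂ) : ℂ :=
  ∫ u in (0 : ℝ)..1, φ u * (n.factorial * (u : ℂ) ^ n / (1 - w * u) ^ (n + 1))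

theorem intervalIntegrable_stieltjesDeriv {φ : ℝ → ℂ} (hφ : IntervalIntegrable φ volume 0 1)
    (n : ℕ) {w : ℂ} (hw : w.re < 1) :
    IntervalIntegrable
      (fun u : ℝ ↦ φ u * (n.factorial * (u : ℂ) ^ n / (1 - w * u) ^ (n + 1))) volume 0 1 := by
  refine hφ.mul_continuousOn ?_
  refine ContinuousOn.div (by fun_prop) (by fun_prop) fun u hu ↦ ?_
  rw [Set.uIcc_of_le zero_le_one] at hu
  exact pow_ne_zero _ (one_sub_mul_ne_zero hw hu.1 hu.2)

theorem hasDerivAt_stieltjesDeriv {φ : ℝ → ℂ} (hφ : IntervalIntegrable φ volume 0 1)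
    (n : ℕ) {w : ℂ} (hw : w.re < 1) :
    HasDerivAt (stieltjesDeriv φ n) (stieltjesDeriv φ (n + 1) w) w := by
  set c : ℝ := min 1 (1 - w.re) / 2 with hc
  have hc₀ : 0 < c := half_pos (lt_min one_pos (sub_pos.mpr hw))
  have hc₁ : c ≤ 1 := by linarith [min_le_left 1 (1 - w.re)]
  have hcw : w.re < 1 - c := by linarith [min_le_right 1 (1 - w.re)]
  refine (intervalIntegral.hasDerivAt_integral_of_dominated_loc_of_deriv_le
    (s := {z : ℂ | z.re < 1 - c})
    (F := fun (z : ℂ) (u : ℝ) ↦ φ u * (n.factorial * (u : ℂ) ^ n / (1 - z * u) ^ (n + 1)))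
    (F' := fun (z : ℂ) (u : ℝ) ↦
      φ u * ((n + 1).factorial * (u : ℂ) ^ (n + 1) / (1 - z * u) ^ (n + 1 + 1)))
    (bound := fun u ↦ ‖φ u‖ * ((n + 1).factorial / c ^ (n + 1 + 1)))
    ((isOpen_lt Complex.continuous_re continuous_const).mem_nhds hcw) ?_
    (intervalIntegrable_stieltjesDeriv hφ n hw)
    (intervalIntegrable_iff.mp
      (intervalIntegrable_stieltjesDeriv hφ (n + 1) hw)).aestronglyMeasurable ?_
    (hφ.norm.mul_const _) ?_).2
  · filter_upwards [isOpen_re_lt_one.mem_nhds hw] with z hz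
    exact (intervalIntegrable_iff.mp
      (intervalIntegrable_stieltjesDeriv hφ n hz)).aestronglyMeasurable
  · refine .of_forall fun u hu z hz ↦ ?_
    rw [Set.uIoc_of_le zero_le_one] at hu
    rw [norm_mul, norm_div, norm_mul, norm_pow, norm_pow, Complex.norm_natCast, Complex.norm_real,
      Real.norm_of_nonneg hu.1.le]
    have := le_norm_one_sub_mul hc₁ (le_of_lt hz) hu.1.le hu.2
    gcongr
    exact mul_le_of_le_one_right (by positivity) (pow_le_one₀ hu.1.le hu.2)
  · refine .of_forall fun u hu z hz ↦ ?_
    rw [Set.uIoc_of_le zero_le_one] at hu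
    have hz1 : z.re < 1 := lt_trans hz (by linarith)
    have h0 := one_sub_mul_ne_zero hz1 hu.1.le hu.2
    have h1 : HasDerivAt (fun z : ℂ ↦ 1 - z * u) (-u) z := by
      simpa using ((hasDerivAt_id z).mul_const (u : ℂ)).const_sub 1
    have h2 := (((h1.pow (n + 1)).inv (pow_ne_zero _ h0)).const_mul
      (n.factorial * (u : ℂ) ^ n)).const_mul (φ u)
    refine h2.congr_deriv ?_
    simp only [Nat.factorial_succ, Pi.pow_apply]
    push_cast
    field_simp
    ring

theorem analyticOnNhd_stieltjesDeriv {φ : ℝ → ℂ} (hφ : IntervalIntegrable φ volume 0 1) (n : ℕ) :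
    AnalyticOnNhd ℂ (stieltjesDeriv φ n) {w | w.re < 1} :=
  DifferentiableOn.analyticOnNhd (fun _ hw ↦
    (hasDerivAt_stieltjesDeriv hφ n hw).differentiableAt.differentiableWithinAt) isOpen_re_lt_one

theorem iteratedDeriv_stieltjesDeriv_zero {φ : ℝ → ℂ} (hφ : IntervalIntegrable φ volume 0 1)
    (n : ℕ) :
    iteratedDeriv n (stieltjesDeriv φ 0) 0 = n.factorial * ∫ u in (0 : ℝ)..1, φ u * (u : ℂ) ^ n := by
  rw [iteratedDeriv_eq_of_hasDerivAt_succ isOpen_re_lt_one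
    (fun n _ hw ↦ hasDerivAt_stieltjesDeriv hφ n hw) n (by simp), stieltjesDeriv,
    ← intervalIntegral.integral_const_mul]
  congr 1 with u
  simp
  ring

/-- The derivative of order `N + k` at `0` of `w ^ N * f w`. -/
theorem iteratedDeriv_pow_mul_zero {f : ℂ → ℂ} (hf : AnalyticAt ℂ f 0) (N k : ℕ) :
    iteratedDeriv (N + k) (fun w ↦ w ^ N * f w) 0 =
      ((N + k).choose N * N.factorial : ℕ) * iteratedDeriv k f 0 := by
  rw [iteratedDeriv_fun_mul (by fun_prop) hf.contDiffAt,
    Finset.sum_eq_single_of_mem N (by simp) fun i _ hi ↦ ?_]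
  · rw [iteratedDeriv_fun_pow_zero, if_pos rfl, add_tsub_cancel_left]
    push_cast
    ring
  · rw [iteratedDeriv_fun_pow_zero, if_neg hi]
    simp

theorem iteratedDeriv_pow_mul_zero_of_lt {f : ℂ → ℂ} (hf : AnalyticAt ℂ f 0) {N k : ℕ}
    (hk : k < N) : iteratedDeriv k (fun w ↦ w ^ N * f w) 0 = 0 := by
  rw [iteratedDeriv_fun_mul (by fun_prop) hf.contDiffAt]
  refine Finset.sum_eq_zero fun i hi ↦ ?_
  have : i ≠ N := by have := Finset.mem_range.mp hi; omega
  rw [iteratedDeriv_fun_pow_zero, if_neg this]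
  simp

theorem Gamma_mul_Gamma_eq_moment {s : ℂ} (hs : -1 < s.re) {m : ℕ} (hm : s.re - 1 < m) (n : ℕ) :
    Complex.Gamma (s + n + 1) * Complex.Gamma (m + 1 - s) =
      (m + n + 1).factorial *
        ∫ u in (0 : ℝ)..1, (u : ℂ) ^ s * (1 - (u : ℂ)) ^ ((m : ℂ) - s) * (u : ℂ) ^ n := by
  rw [Complex.Gamma_mul_Gamma_eq_betaIntegral (by simp; linarith [n.cast_nonneg (α := ℝ)])
    (by simp; linarith), ← Complex.Gamma_nat_eq_factorial, Complex.betaIntegral]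
  congr 1
  · push_cast; ring_nf
  · refine intervalIntegral.integral_congr_ae (.of_forall fun u hu ↦ ?_)
    rw [Set.uIoc_of_le zero_le_one] at hu
    have : (u : ℂ) ≠ 0 := by exact_mod_cast hu.1.ne'
    rw [add_sub_cancel_right, Complex.cpow_add _ _ this, Complex.cpow_natCast,
      show (m : ℂ) + 1 - s - 1 = m - s by ring]
    ring

theorem intervalIntegrable_cpow_mul_one_sub_cpow {s r : ℂ} (hs : -1 < s.re) (hr : -1 < r.re) :
    IntervalIntegrable (fun u : ℝ ↦ (u : ℂ) ^ s * (1 - (u : ℂ)) ^ r) volume 0 1 := by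
  simpa using Complex.betaIntegral_convergent (u := s + 1) (v := r + 1)
    (by simp; linarith) (by simp; linarith)

theorem hasDerivAt_Gamma_mul_one_sub_cpow {s : ℂ} (hs : s ≠ 0) (hs' : -1 < s.re) (n : ℕ) {w : ℂ}
    (hw : w.re < 1) :
    HasDerivAt (fun w ↦ Complex.Gamma (s + n) * (1 - w) ^ (-(s + n)))
      (Complex.Gamma (s + (n + 1 : ℕ)) * (1 - w) ^ (-(s + (n + 1 : ℕ)))) w := by
  have hne : s + n ≠ 0 := by
    intro h
    rcases n.eq_zero_or_pos with rfl | hn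
    · simp at h; exact hs h
    · have := congrArg Complex.re h
      have h1 : (1 : ℝ) ≤ n := by exact_mod_cast hn
      simp at this
      linarith
  have h1 : HasDerivAt (fun w : ℂ ↦ 1 - w) (-1) w := by
    simpa using (hasDerivAt_id w).const_sub 1
  have h2 := (h1.cpow_const (c := -(s + n)) (Or.inl (by simpa using hw))).const_mul
    (Complex.Gamma (s + n))
  refine h2.congr_deriv ?_
  rw [Nat.cast_add, Nat.cast_one, ← add_assoc, Complex.Gamma_add_one _ hne,
    show -(s + n) - 1 = -(s + n + 1) by ring]
  ring

/-- The `m`-th derivative of `w ^ (m + 1) * ∫₀¹ u ^ s (1 - u) ^ (m - s) / (1 - w u) du`. -/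
theorem iteratedDeriv_pow_mul_stieltjesDeriv {s : ℂ} (hs₀ : s ≠ 0) (hs : -1 < s.re) {m : ℕ}
    (hm : s.re - 1 < m) {w : ℂ} (hw : w.re < 1) :
    iteratedDeriv m (fun w ↦ w ^ (m + 1) *
      stieltjesDeriv (fun u ↦ (u : ℂ) ^ s * (1 - (u : ℂ)) ^ ((m : ℂ) - s)) 0 w) w =
      Complex.Gamma s * Complex.Gamma (m + 1 - s) * ((1 - w) ^ (-s) - 1) := by
  have hφ : IntervalIntegrable (fun u : ℝ ↦ (u : ℂ) ^ s * (1 - (u : ℂ)) ^ ((m : ℂ) - s))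
      volume 0 1 := intervalIntegrable_cpow_mul_one_sub_cpow hs (by simp; linarith)
  set K := stieltjesDeriv (fun u ↦ (u : ℂ) ^ s * (1 - (u : ℂ)) ^ ((m : ℂ) - s)) 0 with hK
  have hKa : AnalyticOnNhd ℂ K {w | w.re < 1} := analyticOnNhd_stieltjesDeriv hφ 0
  have h0 : (0 : ℂ) ∈ {w : ℂ | w.re < 1} := by simp
  let g : ℕ → ℂ → ℂ := fun n w ↦ Complex.Gamma (m + 1 - s) *
    (Complex.Gamma (s + n) * (1 - w) ^ (-(s + n)) - if n = 0 then Complex.Gamma s else 0)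
  have hg : ∀ n, ∀ w ∈ {w : ℂ | w.re < 1}, HasDerivAt (g n) (g (n + 1) w) w := fun n w hw ↦ by
    simpa [g] using ((hasDerivAt_Gamma_mul_one_sub_cpow hs₀ hs n hw).sub_const
      (if n = 0 then Complex.Gamma s else 0)).const_mul (Complex.Gamma (m + 1 - s))
  have hga : AnalyticOnNhd ℂ (g 0) {w | w.re < 1} :=
    DifferentiableOn.analyticOnNhd
      (fun w hw ↦ (hg 0 w hw).differentiableAt.differentiableWithinAt) isOpen_re_lt_one
  have hJa : AnalyticOnNhd ℂ (fun w ↦ w ^ (m + 1) * K w) {w | w.re < 1} :=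
    fun w hw ↦ (analyticAt_id.pow _).mul (hKa w hw)
  have hJm : AnalyticOnNhd ℂ (iteratedDeriv m fun w ↦ w ^ (m + 1) * K w) {w | w.re < 1} := by
    rw [iteratedDeriv_eq_iterate]
    exact hJa.iterated_deriv m
  have key := hJm.eqOn_of_iteratedDeriv_eq hga
    (convex_halfSpace_re_lt 1).isPreconnected h0 fun n ↦ by
      rw [iteratedDeriv_eq_of_hasDerivAt_succ isOpen_re_lt_one hg n h0]
      rw [iteratedDeriv_eq_iterate, iteratedDeriv_eq_iterate, ← Function.iterate_add_apply,
        ← iteratedDeriv_eq_iterate]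
      rcases n with _ | n
      · rw [zero_add, iteratedDeriv_pow_mul_zero_of_lt (hKa 0 h0) (Nat.lt_succ_self m)]
        simp [g]
      · rw [show n + 1 + m = m + 1 + n by ring, iteratedDeriv_pow_mul_zero (hKa 0 h0), hK,
          iteratedDeriv_stieltjesDeriv_zero hφ, ← mul_assoc, ← Nat.cast_mul,
          Nat.choose_symm_add, Nat.add_choose_mul_factorial_mul_factorial, show m + 1 + n = m + n + 1 by ring,
          ← Gamma_mul_Gamma_eq_moment hs hm]
        simp [g, ← add_assoc, mul_comm]
  rw [key hw]
  simp [g]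
  ring

/-- Iterated derivatives, along the real line, of a combination of dilates of an analytic
function. -/
theorem iteratedDeriv_comp_mul_ofReal {J : ℂ → ℂ} {a b c d : ℂ}
    (hc : ∀ t : ℝ, AnalyticAt ℂ J (c * t)) (hd : ∀ t : ℝ, AnalyticAt ℂ J (d * t)) (n : ℕ) (t : ℝ) :
    iteratedDeriv n (fun t : ℝ ↦ a * J (c * t) + b * J (d * t)) t =
      a * c ^ n * iteratedDeriv n J (c * t) + b * d ^ n * iteratedDeriv n J (d * t) := by
  have aux : ∀ {e : ℂ} (_ : ∀ t : ℝ, AnalyticAt ℂ J (e * t)) (n : ℕ) (t : ℝ),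
      HasDerivAt (fun t : ℝ ↦ iteratedDeriv n J (e * t))
        (e * iteratedDeriv (n + 1) J (e * t)) t := by
    intro e he n t
    have h1 : HasDerivAt (iteratedDeriv n J) (iteratedDeriv (n + 1) J (e * t)) (e * t) := by
      rw [iteratedDeriv_succ]
      refine DifferentiableAt.hasDerivAt ?_
      rw [iteratedDeriv_eq_iterate]
      exact ((he t).iterated_deriv n).differentiableAt
    have h2 : HasDerivAt (fun t : ℝ ↦ e * (t : ℂ)) e t := by
      simpa using (Complex.ofRealCLM.hasDerivAt (x := t)).const_mul e
    simpa [mul_comm, Function.comp_def] using h1.comp t h2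
  have h := iteratedDeriv_eq_of_hasDerivAt_succ (f := fun (n : ℕ) (t : ℝ) ↦
    a * c ^ n * iteratedDeriv n J (c * t) + b * d ^ n * iteratedDeriv n J (d * t))
    isOpen_univ (fun n t _ ↦ by
      refine (((aux hc n t).const_mul (a * c ^ n)).add
        ((aux hd n t).const_mul (b * d ^ n))).congr_deriv ?_
      ring) n (Set.mem_univ t)
  simpa using h

theorem ofReal_mul_cpow_of_nonneg (t : ℝ) {u : ℝ} (hu : 0 ≤ u) (r : ℂ) :
    ((t * u : ℝ) : ℂ) ^ r = (t : ℂ) ^ r * (u : ℂ) ^ r := by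
  rcases le_total 0 t with ht | ht
  · rw [Complex.ofReal_mul, Complex.mul_cpow_ofReal_nonneg ht hu]
  · rw [Complex.ofReal_cpow_of_nonpos (mul_nonpos_of_nonpos_of_nonneg ht hu),
      Complex.ofReal_cpow_of_nonpos ht, Complex.ofReal_mul, ← neg_mul, ← Complex.ofReal_neg,
      Complex.mul_cpow_ofReal_nonneg (neg_nonneg.mpr ht) hu]
    ring

theorem F_eq_pow_mul_integral (s : ℂ) (m : ℕ) (t : ℝ) :
    F s m t = (t : ℂ) ^ (m + 1) * ∫ u in (0 : ℝ)..1,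
      (u : ℂ) ^ s * (1 - (u : ℂ)) ^ ((m : ℂ) - s) / (1 + (t : ℂ) ^ 2 * (u : ℂ) ^ 2) := by
  rcases eq_or_ne t 0 with rfl | ht
  · simp [F]
  have ht' : (t : ℂ) ≠ 0 := by exact_mod_cast ht
  have h := intervalIntegral.smul_integral_comp_mul_left (a := 0) (b := 1) (fun x : ℝ ↦
    ((x : ℝ) : ℂ) ^ s * ((t - x : ℝ) : ℂ) ^ ((m : ℂ) - s) / (1 + ((x : ℝ) : ℂ) ^ 2)) t
  rw [mul_zero, mul_one] at h
  rw [F, ← h, pow_succ', mul_assoc, ← intervalIntegral.integral_const_mul, Complex.real_smul]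
  congr 1
  refine intervalIntegral.integral_congr fun u hu ↦ ?_
  rw [Set.uIcc_of_le zero_le_one] at hu
  have hpow : (t : ℂ) ^ m = (t : ℂ) ^ s * (t : ℂ) ^ ((m : ℂ) - s) := by
    rw [← Complex.cpow_add _ _ ht', add_sub_cancel, Complex.cpow_natCast]
  rw [show t - t * u = t * (1 - u) by ring, ofReal_mul_cpow_of_nonneg t hu.1,
    ofReal_mul_cpow_of_nonneg t (sub_nonneg.mpr hu.2), hpow]
  push_cast
  ring

theorem re_I_mul_ofReal_lt_one (t : ℝ) : (Complex.I * t).re < 1 := by simp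

theorem re_neg_I_mul_ofReal_lt_one (t : ℝ) : (-Complex.I * t).re < 1 := by simp

theorem F_eq_stieltjesDeriv {s : ℂ} (hs : -1 < s.re) {m : ℕ} (hm : s.re - 1 < m) (t : ℝ) :
    let J := fun w ↦ w ^ (m + 1) *
      stieltjesDeriv (fun u ↦ (u : ℂ) ^ s * (1 - (u : ℂ)) ^ ((m : ℂ) - s)) 0 w
    F s m t = (Complex.I ^ (m + 1))⁻¹ / 2 * J (Complex.I * t) +
      ((-Complex.I) ^ (m + 1))⁻¹ / 2 * J (-Complex.I * t) := by
  intro J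
  have hφ : IntervalIntegrable (fun u : ℝ ↦ (u : ℂ) ^ s * (1 - (u : ℂ)) ^ ((m : ℂ) - s))
      volume 0 1 := intervalIntegrable_cpow_mul_one_sub_cpow hs (by simp; linarith)
  have h₁ := intervalIntegrable_stieltjesDeriv hφ 0 (re_I_mul_ofReal_lt_one t)
  have h₂ := intervalIntegrable_stieltjesDeriv hφ 0 (re_neg_I_mul_ofReal_lt_one t)
  have hI := Complex.I_ne_zero
  have hsum : ∫ u in (0 : ℝ)..1, (u : ℂ) ^ s * (1 - (u : ℂ)) ^ ((m : ℂ) - s) /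
      (1 + (t : ℂ) ^ 2 * (u : ℂ) ^ 2) =
      (stieltjesDeriv (fun u ↦ (u : ℂ) ^ s * (1 - (u : ℂ)) ^ ((m : ℂ) - s)) 0 (Complex.I * t) +
      stieltjesDeriv (fun u ↦ (u : ℂ) ^ s * (1 - (u : ℂ)) ^ ((m : ℂ) - s)) 0 (-Complex.I * t))
        / 2 := by
    rw [stieltjesDeriv, stieltjesDeriv, ← intervalIntegral.integral_add h₁ h₂,
      ← intervalIntegral.integral_div]
    refine intervalIntegral.integral_congr fun u hu ↦ ?_
    rw [Set.uIcc_of_le zero_le_one] at hu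
    have e₁ := one_sub_mul_ne_zero (re_I_mul_ofReal_lt_one t) hu.1 hu.2
    have e₂ := one_sub_mul_ne_zero (re_neg_I_mul_ofReal_lt_one t) hu.1 hu.2
    rw [neg_mul, neg_mul, sub_neg_eq_add] at e₂
    have e₃ : 1 + (t : ℂ) ^ 2 * (u : ℂ) ^ 2 =
        (1 - Complex.I * t * u) * (1 + Complex.I * t * u) := by
      linear_combination ((t : ℂ) ^ 2 * (u : ℂ) ^ 2) * Complex.I_sq
    simp only [e₃, neg_mul, sub_neg_eq_add, Nat.factorial_zero, Nat.cast_one, pow_zero, zero_add, pow_one, mul_one]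
    generalize Complex.I * t * u = a at e₁ e₂ ⊢
    field_simp
    ring
  have hI₁ := pow_ne_zero (m + 1) hI
  have hI₂ := pow_ne_zero (m + 1) (neg_ne_zero.mpr hI)
  simp only [J]
  rw [F_eq_pow_mul_integral, hsum, mul_pow Complex.I, mul_pow (-Complex.I)]
  field_simp

theorem log_one_add_ofReal_mul_I (t : ℝ) :
    Complex.log (1 + t * Complex.I) =
      ((Real.log (1 + t ^ 2) / 2 : ℝ) : ℂ) + Real.arctan t * Complex.I := by
  have hpos : 0 < 1 + t ^ 2 := by positivity
  have hsq : √(1 + t ^ 2) ≠ 0 := (Real.sqrt_pos.mpr hpos).ne'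
  rw [← Complex.log_exp (x := ((Real.log (1 + t ^ 2) / 2 : ℝ) : ℂ) + Real.arctan t * Complex.I)]
  · congr 1
    rw [Complex.exp_add, ← Complex.ofReal_exp, ← Real.log_sqrt hpos.le,
      Real.exp_log (Real.sqrt_pos.mpr hpos), Complex.exp_mul_I, ← Complex.ofReal_cos,
      ← Complex.ofReal_sin, Real.cos_arctan, Real.sin_arctan]
    have : (√(1 + t ^ 2) : ℂ) ≠ 0 := by exact_mod_cast hsq
    push_cast
    field_simp
  · simp [-Complex.ofReal_arctan]; linarith [Real.neg_pi_div_two_lt_arctan t, Real.pi_pos]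
  · simp [-Complex.ofReal_arctan]; linarith [Real.arctan_lt_pi_div_two t, Real.pi_pos]

theorem one_add_ofReal_mul_I_cpow (t : ℝ) (s : ℂ) :
    (1 + t * Complex.I) ^ (-s) =
      Complex.exp (-(s * Real.arctan t) * Complex.I) / ((1 + t ^ 2 : ℝ) : ℂ) ^ (s / 2) := by
  have hpos : 0 < 1 + t ^ 2 := by positivity
  have h0 : 1 + (t : ℂ) * Complex.I ≠ 0 := fun h ↦ by simpa using congrArg Complex.re h
  rw [Complex.cpow_def_of_ne_zero h0, log_one_add_ofReal_mul_I,
    Complex.cpow_def_of_ne_zero (by exact_mod_cast hpos.ne'), ← Complex.ofReal_log hpos.le,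
    ← Complex.exp_sub]
  congr 1
  push_cast
  ring

theorem sin_mul_arctan_div_cpow (s : ℂ) (t : ℝ) :
    Complex.sin (s * Real.arctan t) / ((1 + t ^ 2 : ℝ) : ℂ) ^ (s / 2) =
      ((1 - Complex.I * t) ^ (-s) - (1 - -Complex.I * t) ^ (-s)) / (2 * Complex.I) := by
  have h₁ := one_add_ofReal_mul_I_cpow t s
  have h₂ := one_add_ofReal_mul_I_cpow (-t) s
  rw [show 1 - Complex.I * t = 1 + ((-t : ℝ) : ℂ) * Complex.I by push_cast; ring, h₂,
    show 1 - -Complex.I * t = 1 + (t : ℂ) * Complex.I by ring, h₁, Real.arctan_neg, neg_sq,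
    Complex.sin, Complex.ofReal_neg, mul_neg, neg_neg, ← sub_div, div_right_comm]
  have hI := Complex.I_ne_zero
  field_simp
  rw [Complex.I_sq]
  ring

theorem sin_arctan_eq_iteratedDeriv (s : ℂ) (hs : -1 < s.re)
    (m : ℕ) (hm : s.re - 1 < m) (t : ℝ) (ht : 0 ≤ t) :
    Complex.sin (s * Real.arctan t) / ((1 + t ^ 2 : ℝ) : ℂ) ^ (s / 2) =
      (Complex.Gamma s * Complex.Gamma ((m : ℂ) + 1 - s))⁻¹ * iteratedDeriv m (F s m) t := by
  rcases eq_or_ne s 0 with rfl | hs₀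
  · simp
  have hφ : IntervalIntegrable (fun u : ℝ ↦ (u : ℂ) ^ s * (1 - (u : ℂ)) ^ ((m : ℂ) - s))
      volume 0 1 := intervalIntegrable_cpow_mul_one_sub_cpow hs (by simp; linarith)
  have hJ : ∀ w : ℂ, w.re < 1 → AnalyticAt ℂ (fun w ↦ w ^ (m + 1) *
      stieltjesDeriv (fun u ↦ (u : ℂ) ^ s * (1 - (u : ℂ)) ^ ((m : ℂ) - s)) 0 w) w :=
    fun w hw ↦ (analyticAt_id.pow _).mul (analyticOnNhd_stieltjesDeriv hφ 0 w hw)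
  have hΓ : Complex.Gamma s ≠ 0 := by
    refine Complex.Gamma_ne_zero fun n hn ↦ ?_
    rcases n.eq_zero_or_pos with rfl | hpos
    · exact hs₀ (by simpa using hn)
    · have h1 : (1 : ℝ) ≤ n := by exact_mod_cast hpos
      rw [hn] at hs
      simp at hs
      linarith
  have hΓ' : Complex.Gamma ((m : ℂ) + 1 - s) ≠ 0 :=
    Complex.Gamma_ne_zero_of_re_pos (by simp; linarith)
  rw [funext (F_eq_stieltjesDeriv hs hm), iteratedDeriv_comp_mul_ofReal
    (fun t ↦ hJ _ (re_I_mul_ofReal_lt_one t)) (fun t ↦ hJ _ (re_neg_I_mul_ofReal_lt_one t)),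
    iteratedDeriv_pow_mul_stieltjesDeriv hs₀ hs hm (re_I_mul_ofReal_lt_one t),
    iteratedDeriv_pow_mul_stieltjesDeriv hs₀ hs hm (re_neg_I_mul_ofReal_lt_one t),
    sin_mul_arctan_div_cpow]
  have hI := Complex.I_ne_zero
  have hI₁ := pow_ne_zero m hI
  have hI₂ := pow_ne_zero m (neg_ne_zero.mpr hI)
  rw [pow_succ, pow_succ]
  field_simp
  ring
end
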